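/- Let (δ_n) be a real sequence, (γ_n) a sequence of strictly positive reals, and (σ_n) a sequence of strictly positive reals. Then the infinite product measures ⊗_{n∈ℕ} μ(δ_n, γ_n) and ⊗_{n∈ℕ} μ(δ_n, σ_n γ_n) on ℝ^ℕ are mutually absolutely continuous (equivalent) if and only if ∑_{n} (σ_n − 1)² < ∞. -/

import Mathlib

open MeasureTheory Real

/-- The Cauchy measure on `ℝ` with location parameter `δ` and scale parameter `γ`. -/
noncomputable def cauchyMeasure (δ γ : ℝ) : Measure ℝ :=
  volume.withDensity fun x => ENNReal.ofReal (γ / (π * ((x - δ) ^ 2 + γ ^ 2)))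

open ProbabilityTheory Filter Topology ENNReal in
/-- The product of measures with densities has the product density. -/
theorem Measure.pi_withDensity_eq {ι : Type*} [Fintype ι] {X : ι → Type*}
    [∀ i, MeasurableSpace (X i)] (μ : ∀ i, Measure (X i)) [∀ i, IsProbabilityMeasure (μ i)]
    {r : ∀ i, X i → ℝ≥0∞} (hr : ∀ i, Measurable (r i))
    [∀ i, IsProbabilityMeasure ((μ i).withDensity (r i))] :
    Measure.pi (fun i => (μ i).withDensity (r i)) =
      (Measure.pi μ).withDensity fun x => ∏ i, r i (x i) := by
  classical
  refine Measure.pi_eq fun s hs => ?_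
  have hind : iIndepFun (fun i (x : ∀ i, X i) => (s i).indicator (r i) (x i)) (Measure.pi μ) :=
    iIndepFun_pi fun i => ((hr i).indicator (hs i)).aemeasurable
  have hm : ∀ i, Measurable fun x : ∀ i, X i => (s i).indicator (r i) (x i) :=
    fun i => ((hr i).indicator (hs i)).comp (measurable_pi_apply i)
  have key := lintegral_prod_eq_prod_lintegral_of_indepFun Finset.univ _ hind hm
  rw [withDensity_apply _ (MeasurableSet.univ_pi hs), ← lintegral_indicator (.univ_pi hs)]
  calc _ = ∫⁻ x, ∏ i, (s i).indicator (r i) (x i) ∂Measure.pi μ := by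
        congr 1 with x
        by_cases hx : x ∈ Set.univ.pi s
        · rw [Set.indicator_of_mem hx]
          exact Finset.prod_congr rfl fun i _ =>
            (Set.indicator_of_mem (hx i (Set.mem_univ i)) _).symm
        · rw [Set.indicator_of_notMem hx]
          obtain ⟨i, hi⟩ : ∃ i, x i ∉ s i := by simpa [Set.mem_pi] using hx
          exact (Finset.prod_eq_zero (Finset.mem_univ i) (Set.indicator_of_notMem hi _)).symm
    _ = _ := by
        rw [key]
        refine Finset.prod_congr rfl fun i _ => ?_
        rw [(measurePreserving_eval μ i).lintegral_comp ((hr i).indicator (hs i)),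
          withDensity_apply _ (hs i), lintegral_indicator (hs i)]

open ProbabilityTheory Filter Topology ENNReal in
theorem lintegral_pi_prod_density_sq {ι : Type*} [Fintype ι] {X : ι → Type*}
    [∀ i, MeasurableSpace (X i)] (μ : ∀ i, Measure (X i)) [∀ i, IsProbabilityMeasure (μ i)]
    {r : ∀ i, X i → ℝ≥0∞} (hr : ∀ i, Measurable (r i)) :
    ∫⁻ x, (∏ i, r i (x i)) ^ 2 ∂Measure.pi μ = ∏ i, ∫⁻ x, r i x ^ 2 ∂μ i := by
  have hind : iIndepFun (fun i (x : ∀ i, X i) => r i (x i) ^ 2) (Measure.pi μ) :=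
    iIndepFun_pi (X := fun i x => r i x ^ 2) fun i => ((hr i).pow_const 2).aemeasurable
  have key := lintegral_prod_eq_prod_lintegral_of_indepFun Finset.univ _ hind
    fun i => ((hr i).pow_const 2).comp (measurable_pi_apply i)
  simp_rw [← Finset.prod_pow]
  rw [key]
  exact Finset.prod_congr rfl fun i _ =>
    (measurePreserving_eval μ i).lintegral_comp ((hr i).pow_const 2)

open ENNReal in
theorem withDensity_apply_le_of_lintegral_sq_le {α : Type*} [MeasurableSpace α] (μ : Measure α)
    {f : α → ℝ≥0∞} (hf : Measurable f) {C K : ℝ≥0∞} (hC : ∫⁻ x, f x ^ 2 ∂μ ≤ C)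
    (hK : K ≠ 0) (hK' : K ≠ ∞) {s : Set α} (hs : MeasurableSet s) :
    μ.withDensity f s ≤ K * μ s + C / K := by
  have hle : ∀ x, f x ≤ K + f x ^ 2 / K := fun x => by
    rcases le_total (f x) K with h | h
    · exact h.trans le_self_add
    · refine le_trans ?_ le_add_self
      rw [ENNReal.le_div_iff_mul_le (.inl hK) (.inl hK'), sq]
      gcongr
  rw [withDensity_apply _ hs]
  calc ∫⁻ x in s, f x ∂μ ≤ ∫⁻ x in s, (K + f x ^ 2 / K) ∂μ := lintegral_mono hle
    _ = K * μ s + ∫⁻ x in s, f x ^ 2 / K ∂μ := by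
        rw [lintegral_add_left measurable_const, setLIntegral_const]
    _ ≤ K * μ s + ∫⁻ x, f x ^ 2 / K ∂μ := by gcongr; exact Measure.restrict_le_self
    _ ≤ K * μ s + C / K := by
        simp_rw [div_eq_mul_inv]
        rw [lintegral_mul_const _ (hf.pow_const 2)]
        gcongr

open Filter Topology ENNReal in
/-- A product measure whose marginal densities have bounded products of second moments is
absolutely continuous. -/
theorem infinitePi_withDensity_absolutelyContinuous {ι : Type*} {X : ι → Type*}
    [∀ i, MeasurableSpace (X i)] (μ : ∀ i, Measure (X i)) [∀ i, IsProbabilityMeasure (μ i)]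
    {r : ∀ i, X i → ℝ≥0∞} (hr : ∀ i, Measurable (r i))
    [∀ i, IsProbabilityMeasure ((μ i).withDensity (r i))] {C : ℝ≥0∞} (hC : C ≠ ∞)
    (hrC : ∀ I : Finset ι, ∏ i ∈ I, ∫⁻ x, r i x ^ 2 ∂μ i ≤ C) :
    Measure.infinitePi (fun i => (μ i).withDensity (r i)) ≪ Measure.infinitePi μ := by
  set P := Measure.infinitePi μ
  set Q := Measure.infinitePi fun i => (μ i).withDensity (r i)
  have cyl : ∀ B ∈ measurableCylinders X, ∀ K : ℝ≥0∞, K ≠ 0 → K ≠ ∞ →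
      Q B ≤ K * P B + C / K := by
    intro B hB K hK hK'
    obtain ⟨I, S, hS, rfl⟩ := (mem_measurableCylinders B).1 hB
    rw [Measure.infinitePi_cylinder _ hS, Measure.infinitePi_cylinder _ hS,
      Measure.pi_withDensity_eq _ fun i : I => hr i]
    refine withDensity_apply_le_of_lintegral_sq_le _
      (f := fun x : ∀ i : I, X i => ∏ i : I, r i (x i))
      (Finset.measurable_prod _ fun i _ => (hr i).comp (measurable_pi_apply i)) ?_ hK hK' hS
    rw [lintegral_pi_prod_density_sq _ fun i : I => hr i]
    exact (Finset.prod_coe_sort I fun i => ∫⁻ x, r i x ^ 2 ∂μ i).trans_le (hrC I)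
  refine Measure.AbsolutelyContinuous.mk fun A hA hPA => ?_
  have approx : ∀ K : ℝ≥0∞, K ≠ 0 → K ≠ ∞ → Q A ≤ C / K := by
    intro K hK hK'
    have hε : ∀ ε : ℝ≥0∞, 0 < ε → Q A ≤ (K + 1) * ε + C / K := by
      intro ε hε
      obtain ⟨B, hB, hBA⟩ := exists_measure_symmDiff_lt_of_generateFrom_isSetRing
        (μ := P + Q) isSetRing_measurableCylinders
        ⟨{Set.univ}, Set.countable_singleton _, by
          simpa using univ_mem_measurableCylinders X, by simp⟩
        generateFrom_measurableCylinders.symm hA hε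
      rw [Measure.add_apply] at hBA
      have hPB : P B ≤ ε := by
        calc P B ≤ P (symmDiff B A ∪ A) := measure_mono fun x hx => by
              by_cases h : x ∈ A
              · exact .inr h
              · exact .inl (.inl ⟨hx, h⟩)
          _ ≤ P (symmDiff B A) + P A := measure_union_le _ _
          _ ≤ ε := by rw [hPA, add_zero]; exact le_self_add.trans hBA.le
      calc Q A ≤ Q (symmDiff B A ∪ B) := measure_mono fun x hx => by
              by_cases h : x ∈ B
              · exact .inr h
              · exact .inl (.inr ⟨hx, h⟩)
        _ ≤ Q (symmDiff B A) + Q B := measure_union_le _ _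
        _ ≤ ε + (K * ε + C / K) := by
            gcongr
            · exact le_add_self.trans hBA.le
            · exact (cyl B hB K hK hK').trans (by gcongr)
        _ = (K + 1) * ε + C / K := by ring
    have hlim : Tendsto (fun ε : ℝ≥0∞ => (K + 1) * ε + C / K) (𝓝[>] 0)
        (𝓝 ((K + 1) * 0 + C / K)) :=
      (ENNReal.Tendsto.const_mul tendsto_id (.inr (by finiteness))).add_const _
        |>.mono_left nhdsWithin_le_nhds
    rw [mul_zero, zero_add] at hlim
    exact ge_of_tendsto hlim (eventually_mem_nhdsWithin.mono hε)
  have hlim : Tendsto (fun n : ℕ => C / (n : ℝ≥0∞)) atTop (𝓝 0) := by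
    simp_rw [div_eq_mul_inv]
    simpa using ENNReal.Tendsto.const_mul ENNReal.tendsto_inv_nat_nhds_zero (.inr hC)
  refine le_antisymm (ge_of_tendsto hlim ?_) zero_le
  filter_upwards [eventually_ne_atTop 0] with n hn
  exact approx n (by exact_mod_cast hn) (by finiteness)

open ProbabilityTheory Filter Topology in
theorem infinitePi_sum_deviation_le {X : ℕ → Type*} [∀ i, MeasurableSpace (X i)]
    (μ : ∀ i, Measure (X i)) [∀ i, IsProbabilityMeasure (μ i)] {φ : ∀ i, X i → ℝ}
    (hφ : ∀ i, Measurable (φ i)) (hφ' : ∀ i x, φ i x ∈ Set.Icc (0 : ℝ) 1) (m : ℕ → ℝ) (n : ℕ)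
    (hM : 0 < ∑ i ∈ Finset.range n, m i ^ 2) :
    Measure.infinitePi μ {x | (∑ i ∈ Finset.range n, m i ^ 2) / 2 ≤
        |∑ i ∈ Finset.range n, m i * φ i (x i) - ∑ i ∈ Finset.range n, m i * ∫ y, φ i y ∂μ i|} ≤
      ENNReal.ofReal (4 / ∑ i ∈ Finset.range n, m i ^ 2) := by
  set M := ∑ i ∈ Finset.range n, m i ^ 2
  set P := Measure.infinitePi μ
  have hφint : ∀ i, MemLp (fun x : ∀ i, X i => φ i (x i)) 2 P := fun i =>
    MemLp.of_bound ((hφ i).comp (measurable_pi_apply i)).aestronglyMeasurable 1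
      (.of_forall fun x => by
        rw [Real.norm_eq_abs, abs_of_nonneg (hφ' i _).1]; exact (hφ' i _).2)
  have hL : ∀ i, MemLp (fun x : ∀ i, X i => m i * φ i (x i)) 2 P := fun i =>
    (hφint i).const_mul _
  have hind : iIndepFun (fun i (x : ∀ i, X i) => m i * φ i (x i)) P :=
    iIndepFun_infinitePi (X := fun i x => m i * φ i x) fun i => (hφ i).const_mul _
  have hvar : Var[∑ i ∈ Finset.range n, fun x : ∀ i, X i => m i * φ i (x i); P] ≤ M := by
    rw [IndepFun.variance_sum (fun i _ => hL i) fun i _ j _ hij => hind.indepFun hij]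
    refine Finset.sum_le_sum fun i _ => ?_
    rw [variance_const_mul]
    have := variance_le_sq_of_bounded (μ := P) (a := 0) (b := 1)
      (.of_forall fun x => hφ' i (x i)) ((hφ i).comp (measurable_pi_apply i)).aemeasurable
    nlinarith [sq_nonneg (m i)]
  have hmean : ∫ x, (∑ i ∈ Finset.range n, fun x : ∀ i, X i => m i * φ i (x i)) x ∂P =
      ∑ i ∈ Finset.range n, m i * ∫ y, φ i y ∂μ i := by
    simp_rw [Finset.sum_apply]
    rw [integral_finsetSum _ fun i _ => (hL i).integrable (by norm_num)]
    refine Finset.sum_congr rfl fun i _ => ?_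
    rw [integral_const_mul, ← (measurePreserving_eval_infinitePi μ i).map_eq,
      integral_map (measurable_pi_apply i).aemeasurable (hφ i).aestronglyMeasurable]
  have key := meas_ge_le_variance_div_sq
    (memLp_finsetSum' (Finset.range n) fun i _ => hL i) (half_pos hM)
  rw [hmean] at key
  simp_rw [Finset.sum_apply] at key
  refine key.trans (ENNReal.ofReal_le_ofReal ?_)
  rw [div_le_div_iff₀ (by positivity) hM]
  nlinarith

open ProbabilityTheory Filter Topology in
/-- Absolute continuity of product measures forces the expectations of uniformly bounded marginal
observables to be square-summably close. -/
theorem summable_sq_integral_sub_of_infinitePi_absolutelyContinuous {X : ℕ → Type*}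
    [∀ i, MeasurableSpace (X i)]
    (μ ν : ∀ i, Measure (X i)) [∀ i, IsProbabilityMeasure (μ i)] [∀ i, IsProbabilityMeasure (ν i)]
    {φ : ∀ i, X i → ℝ}
    (hφ : ∀ i, Measurable (φ i)) (hφ' : ∀ i x, φ i x ∈ Set.Icc (0 : ℝ) 1)
    (hac : Measure.infinitePi ν ≪ Measure.infinitePi μ) :
    Summable fun i => (∫ x, φ i x ∂ν i - ∫ x, φ i x ∂μ i) ^ 2 := by
  by_contra hns
  set m : ℕ → ℝ := fun i => ∫ x, φ i x ∂ν i - ∫ x, φ i x ∂μ i with hm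
  set P := Measure.infinitePi μ
  set Q := Measure.infinitePi ν
  have hM := (not_summable_iff_tendsto_nat_atTop_of_nonneg fun i => sq_nonneg (m i)).1 hns
  set M : ℕ → ℝ := fun n => ∑ i ∈ Finset.range n, m i ^ 2
  set A : ℕ → Set (∀ i, X i) := fun n => {x | M n / 2 ≤
    |∑ i ∈ Finset.range n, m i * φ i (x i) - ∑ i ∈ Finset.range n, m i * ∫ y, φ i y ∂μ i|}
  have hA : ∀ n, MeasurableSet (A n) := fun n => by
    have : Measurable fun x : ∀ i, X i => ∑ i ∈ Finset.range n, m i * φ i (x i) :=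
      Finset.measurable_sum _ fun i _ => ((hφ i).comp (measurable_pi_apply i)).const_mul _
    exact measurableSet_le measurable_const (this.sub_const _).abs
  have hlim : Tendsto (fun n => ENNReal.ofReal (4 / M n)) atTop (𝓝 0) := by
    simpa using ENNReal.tendsto_ofReal (tendsto_const_nhds.div_atTop hM)
  have hPA : Tendsto (fun n => P (A n)) atTop (𝓝 0) :=
    tendsto_of_tendsto_of_tendsto_of_le_of_le' tendsto_const_nhds hlim
      (.of_forall fun _ => zero_le) <| by
        filter_upwards [hM.eventually_gt_atTop 0] with n hn
        exact infinitePi_sum_deviation_le μ hφ hφ' m n hn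
  have hQAc : Tendsto (fun n => Q (A n)ᶜ) atTop (𝓝 0) :=
    tendsto_of_tendsto_of_tendsto_of_le_of_le' tendsto_const_nhds hlim
      (.of_forall fun _ => zero_le) <| by
        filter_upwards [hM.eventually_gt_atTop 0] with n hn
        refine (measure_mono fun x hx => ?_).trans (infinitePi_sum_deviation_le ν hφ hφ' m n hn)
        have hdiff : ∑ i ∈ Finset.range n, m i * ∫ y, φ i y ∂ν i -
            ∑ i ∈ Finset.range n, m i * ∫ y, φ i y ∂μ i = M n := by
          rw [← Finset.sum_sub_distrib]
          exact Finset.sum_congr rfl fun i _ => by simp only [hm]; ring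
        have hx' := (abs_lt.1 (not_le.1 (Set.mem_ofPred_eq ▸ hx : ¬ M n / 2 ≤ _))).2
        refine Set.mem_ofPred_eq ▸ le_trans (?_ : M n / 2 ≤ _) (neg_le_abs _)
        linarith
  have hQA : Tendsto (fun n => Q (A n)) atTop (𝓝 0) := by
    have := tendsto_setLIntegral_zero (μ := P) (f := Q.rnDeriv P)
      (Measure.lintegral_rnDeriv_lt_top Q P).ne hPA
    simpa only [Measure.setLIntegral_rnDeriv hac] using this
  have hsum := hQA.add hQAc
  simp_rw [measure_add_measure_compl (hA _), measure_univ, add_zero] at hsum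
  exact one_ne_zero (tendsto_nhds_unique tendsto_const_nhds hsum)

theorem cauchyMeasure_eq_probabilityTheory (δ : ℝ) {γ : ℝ} (hγ : 0 < γ) :
    cauchyMeasure δ γ = ProbabilityTheory.cauchyMeasure δ γ.toNNReal := by
  rw [ProbabilityTheory.cauchyMeasure_of_scale_ne_zero _ (by simpa using hγ), cauchyMeasure]
  congr with x
  simp only [ProbabilityTheory.cauchyPDF, ProbabilityTheory.cauchyPDFReal,
    Real.coe_toNNReal _ hγ.le]
  congr 1
  field_simp

theorem isProbabilityMeasure_cauchyMeasure (δ : ℝ) {γ : ℝ} (hγ : 0 < γ) :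
    IsProbabilityMeasure (cauchyMeasure δ γ) := by
  rw [cauchyMeasure_eq_probabilityTheory δ hγ]
  infer_instance

theorem integral_cauchyMeasure (δ : ℝ) {γ : ℝ} (hγ : 0 < γ) (f : ℝ → ℝ) :
    ∫ x, f x ∂cauchyMeasure δ γ = ∫ x, γ / (π * ((x - δ) ^ 2 + γ ^ 2)) * f x := by
  rw [cauchyMeasure, integral_withDensity_eq_integral_toReal_smul (by fun_prop) (by simp)]
  refine integral_congr_ae (.of_forall fun x => ?_)
  simp only [smul_eq_mul]
  rw [ENNReal.toReal_ofReal (by positivity)]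

theorem integrable_inv_sq_add_sq {a : ℝ} (ha : 0 < a) :
    Integrable fun x : ℝ => (x ^ 2 + a ^ 2)⁻¹ := by
  refine ((integrable_inv_one_add_sq.comp_div ha.ne').const_mul (a ^ 2)⁻¹).congr
    (.of_forall fun x => ?_)
  field_simp
  ring

theorem integral_univ_inv_sq_add_sq {a : ℝ} (ha : 0 < a) : ∫ x : ℝ, (x ^ 2 + a ^ 2)⁻¹ = π / a := by
  have h : ∀ x : ℝ, (x ^ 2 + a ^ 2)⁻¹ = (a ^ 2)⁻¹ * (1 + (x / a) ^ 2)⁻¹ := fun x => by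
    field_simp
    ring
  simp_rw [h]
  rw [integral_const_mul, Measure.integral_comp_div (fun x : ℝ => (1 + x ^ 2)⁻¹),
    integral_univ_inv_one_add_sq, abs_of_pos ha, smul_eq_mul]
  field_simp

theorem integrable_inv_mul_inv {a b : ℝ} (ha : 0 < a) (hb : 0 < b) :
    Integrable fun x : ℝ => (x ^ 2 + a ^ 2)⁻¹ * (x ^ 2 + b ^ 2)⁻¹ := by
  refine (integrable_inv_sq_add_sq ha).mul_bdd (c := (b ^ 2)⁻¹)
    (by fun_prop) (.of_forall fun x => ?_)
  rw [norm_of_nonneg (by positivity)]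
  gcongr
  nlinarith [sq_nonneg x]

open Filter Topology in
theorem tendsto_div_sq_add_sq (a : ℝ) {l : Filter ℝ} (hl : Tendsto (fun x : ℝ => x⁻¹) l (𝓝 0)) :
    Tendsto (fun x : ℝ => x / (x ^ 2 + a ^ 2)) l (𝓝 0) := by
  refine squeeze_zero_norm (fun x => ?_) (by simpa using hl.norm)
  rcases eq_or_ne x 0 with rfl | hx
  · simp
  · rw [norm_div, norm_of_nonneg (by positivity : 0 ≤ x ^ 2 + a ^ 2),
      div_le_iff₀ (by positivity), Real.norm_eq_abs, ← div_eq_inv_mul, le_div_iff₀ (by positivity)]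
    nlinarith [abs_mul_abs_self x, sq_nonneg a]

open Filter Topology in
theorem integral_inv_mul_inv {a b : ℝ} (ha : 0 < a) (hb : 0 < b) :
    ∫ x : ℝ, (x ^ 2 + a ^ 2)⁻¹ * (x ^ 2 + b ^ 2)⁻¹ = π / (a * b * (a + b)) := by
  rcases eq_or_ne a b with rfl | hab
  · have hder : ∀ x : ℝ, HasDerivAt (fun x : ℝ => x / (x ^ 2 + a ^ 2))
        (2 * a ^ 2 * ((x ^ 2 + a ^ 2)⁻¹ * (x ^ 2 + a ^ 2)⁻¹) - (x ^ 2 + a ^ 2)⁻¹) x := fun x => by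
      have hx : x ^ 2 + a ^ 2 ≠ 0 := by positivity
      refine ((hasDerivAt_id' x).div ((hasDerivAt_pow 2 x).add_const (a ^ 2)) hx).congr_deriv ?_
      field_simp
      push_cast
      ring
    have hI := (integrable_inv_mul_inv ha ha).const_mul (2 * a ^ 2)
    have h := integral_of_hasDerivAt_of_tendsto hder (hI.sub (integrable_inv_sq_add_sq ha))
      (tendsto_div_sq_add_sq a tendsto_inv_atBot_zero)
      (tendsto_div_sq_add_sq a tendsto_inv_atTop_zero)
    rw [integral_sub hI (integrable_inv_sq_add_sq ha), integral_const_mul,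
      integral_univ_inv_sq_add_sq ha] at h
    field_simp at h ⊢
    linarith
  · have hne : b ^ 2 - a ^ 2 ≠ 0 := by
      rw [sq_sub_sq]
      exact mul_ne_zero (by positivity) (sub_ne_zero.2 hab.symm)
    have h : ∀ x : ℝ, (x ^ 2 + a ^ 2)⁻¹ * (x ^ 2 + b ^ 2)⁻¹ =
        (b ^ 2 - a ^ 2)⁻¹ * ((x ^ 2 + a ^ 2)⁻¹ - (x ^ 2 + b ^ 2)⁻¹) := fun x => by
      have h1 : x ^ 2 + a ^ 2 ≠ 0 := by positivity
      have h2 : x ^ 2 + b ^ 2 ≠ 0 := by positivity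
      field_simp
      ring
    simp_rw [h]
    rw [integral_const_mul, integral_sub (integrable_inv_sq_add_sq ha)
      (integrable_inv_sq_add_sq hb), integral_univ_inv_sq_add_sq ha, integral_univ_inv_sq_add_sq hb]
    field_simp
    ring

theorem integral_cauchyMeasure_sq_div (δ : ℝ) {a b : ℝ} (ha : 0 < a) (hb : 0 < b) :
    ∫ x, b ^ 2 / ((x - δ) ^ 2 + b ^ 2) ∂cauchyMeasure δ a = b / (a + b) := by
  rw [integral_cauchyMeasure δ ha, integral_sub_right_eq_self
    (fun x : ℝ => a / (π * (x ^ 2 + a ^ 2)) * (b ^ 2 / (x ^ 2 + b ^ 2))) δ]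
  have h : ∀ x : ℝ, a / (π * (x ^ 2 + a ^ 2)) * (b ^ 2 / (x ^ 2 + b ^ 2)) =
      a * b ^ 2 / π * ((x ^ 2 + a ^ 2)⁻¹ * (x ^ 2 + b ^ 2)⁻¹) := fun x => by
    field_simp
  simp_rw [h]
  rw [integral_const_mul, integral_inv_mul_inv ha hb]
  field_simp

theorem sq_div_mem_Icc (δ : ℝ) {b : ℝ} (hb : 0 < b) (x : ℝ) :
    b ^ 2 / ((x - δ) ^ 2 + b ^ 2) ∈ Set.Icc (0 : ℝ) 1 :=
  ⟨by positivity, div_le_one_of_le₀ (by nlinarith [sq_nonneg (x - δ)]) (by positivity)⟩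

/-- The density of `cauchyMeasure δ (s * γ)` with respect to `cauchyMeasure δ γ`. -/
noncomputable def cauchyRatio (δ γ s x : ℝ) : ℝ :=
  s * ((x - δ) ^ 2 + γ ^ 2) / ((x - δ) ^ 2 + (s * γ) ^ 2)

theorem measurable_cauchyRatio (δ γ s : ℝ) : Measurable (cauchyRatio δ γ s) := by
  unfold cauchyRatio
  fun_prop

theorem cauchyMeasure_withDensity_cauchyRatio (δ : ℝ) {γ s : ℝ} (hγ : 0 < γ) (hs : 0 < s) :
    (cauchyMeasure δ γ).withDensity (fun x => ENNReal.ofReal (cauchyRatio δ γ s x)) =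
      cauchyMeasure δ (s * γ) := by
  rw [cauchyMeasure, cauchyMeasure, ← withDensity_mul _ (by fun_prop)
    (measurable_cauchyRatio δ γ s).ennreal_ofReal]
  congr with x
  rw [Pi.mul_apply, ← ENNReal.ofReal_mul (by positivity), cauchyRatio]
  congr 1
  field_simp

theorem lintegral_cauchyRatio_sq (δ : ℝ) {γ s : ℝ} (hγ : 0 < γ) (hs : 0 < s) :
    ∫⁻ x, ENNReal.ofReal (cauchyRatio δ γ s x) ^ 2 ∂cauchyMeasure δ γ =
      ENNReal.ofReal (1 + (s - 1) ^ 2 / (2 * s)) := by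
  have hsγ : 0 < s * γ := mul_pos hs hγ
  have hm := (measurable_cauchyRatio δ γ s).ennreal_ofReal
  have := isProbabilityMeasure_cauchyMeasure δ hsγ
  have hr : ∀ x, cauchyRatio δ γ s x =
      s + (1 - s ^ 2) / s * ((s * γ) ^ 2 / ((x - δ) ^ 2 + (s * γ) ^ 2)) := fun x => by
    have : (x - δ) ^ 2 + (s * γ) ^ 2 ≠ 0 := by positivity
    rw [cauchyRatio]
    field_simp
    ring
  have hI : Integrable (fun x => (s * γ) ^ 2 / ((x - δ) ^ 2 + (s * γ) ^ 2))
      (cauchyMeasure δ (s * γ)) :=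
    .of_bound (Measurable.aestronglyMeasurable (by fun_prop)) 1 (.of_forall fun x => by
      rw [norm_of_nonneg (sq_div_mem_Icc δ hsγ x).1]
      exact (sq_div_mem_Icc δ hsγ x).2)
  have hI' : Integrable (cauchyRatio δ γ s) (cauchyMeasure δ (s * γ)) :=
    ((integrable_const s).add (hI.const_mul _)).congr (.of_forall fun x => (hr x).symm)
  have h0 : ∀ x, 0 ≤ cauchyRatio δ γ s x := fun x => by
    rw [cauchyRatio]
    positivity
  simp_rw [sq (ENNReal.ofReal _)]
  have h := lintegral_withDensity_eq_lintegral_mul (cauchyMeasure δ γ) hm hm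
  simp only [Pi.mul_apply] at h
  rw [← h, cauchyMeasure_withDensity_cauchyRatio δ hγ hs,
    ← ofReal_integral_eq_lintegral_ofReal hI' (.of_forall h0)]
  simp_rw [hr]
  rw [integral_add (integrable_const s) (hI.const_mul _), integral_const_mul,
    integral_cauchyMeasure_sq_div δ hsγ hsγ]
  congr 1
  simp
  field_simp
  ring

/-- A square-summable dilation of the scales yields an absolutely continuous product. -/
theorem infinitePi_cauchyMeasure_absolutelyContinuous {ι : Type*} {δ γ s : ι → ℝ}
    (hγ : ∀ i, 0 < γ i) (hs : ∀ i, 0 < s i) (hsum : Summable fun i => (s i - 1) ^ 2 / s i) :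
    Measure.infinitePi (fun i => cauchyMeasure (δ i) (s i * γ i)) ≪
      Measure.infinitePi fun i => cauchyMeasure (δ i) (γ i) := by
  have := fun i => isProbabilityMeasure_cauchyMeasure (δ i) (hγ i)
  have hd := fun i => cauchyMeasure_withDensity_cauchyRatio (δ i) (hγ i) (hs i)
  have (i : ι) : IsProbabilityMeasure ((cauchyMeasure (δ i) (γ i)).withDensity
      fun x => ENNReal.ofReal (cauchyRatio (δ i) (γ i) (s i) x)) := by
    rw [hd]
    exact isProbabilityMeasure_cauchyMeasure _ (mul_pos (hs i) (hγ i))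
  have hac := infinitePi_withDensity_absolutelyContinuous
    (fun i => cauchyMeasure (δ i) (γ i))
    (fun i => (measurable_cauchyRatio (δ i) (γ i) (s i)).ennreal_ofReal)
    (C := ENNReal.ofReal (exp (∑' i, (s i - 1) ^ 2 / s i))) ENNReal.ofReal_ne_top fun I => ?_
  · simpa only [hd] using hac
  have h0 : ∀ i, 0 ≤ (s i - 1) ^ 2 / s i := fun i => div_nonneg (sq_nonneg _) (hs i).le
  have h1 : ∀ i, (s i - 1) ^ 2 / (2 * s i) = (s i - 1) ^ 2 / s i / 2 := fun i => by
    rw [div_div, mul_comm]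
  simp_rw [lintegral_cauchyRatio_sq _ (hγ _) (hs _), h1]
  rw [← ENNReal.ofReal_prod_of_nonneg fun i _ => by linarith [h0 i]]
  refine ENNReal.ofReal_le_ofReal ?_
  calc ∏ i ∈ I, (1 + (s i - 1) ^ 2 / s i / 2) ≤ ∏ i ∈ I, exp ((s i - 1) ^ 2 / s i) :=
        Finset.prod_le_prod (fun i _ => by linarith [h0 i]) fun i _ => by
          linarith [h0 i, add_one_le_exp ((s i - 1) ^ 2 / s i)]
    _ = exp (∑ i ∈ I, (s i - 1) ^ 2 / s i) := (exp_sum I _).symm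
    _ ≤ _ := exp_le_exp.2 (hsum.sum_le_tsum I fun i _ => h0 i)

open Filter in
theorem summable_sq_sub_one_div {σ : ℕ → ℝ} (hσ : ∀ n, 0 < σ n)
    (h : Summable fun n => (σ n - 1) ^ 2) : Summable fun n => (σ n - 1) ^ 2 / σ n := by
  refine (h.mul_left 2).of_norm_bounded_eventually_nat ?_
  filter_upwards [h.tendsto_atTop_zero.eventually_lt_const (by norm_num : (0 : ℝ) < 1 / 4)]
    with n hn
  have hσn : 1 / 2 ≤ σ n := by nlinarith
  rw [norm_of_nonneg (div_nonneg (sq_nonneg _) (hσ n).le), div_le_iff₀ (hσ n)]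
  nlinarith [sq_nonneg (σ n - 1)]

open Filter in
theorem summable_sq_sub_one_of_summable_sq_inv_sub {σ : ℕ → ℝ} (hσ : ∀ n, 0 < σ n)
    (h : Summable fun n => (1 / (σ n + 1) - 1 / 2) ^ 2) : Summable fun n => (σ n - 1) ^ 2 := by
  refine (h.mul_left 36).of_norm_bounded_eventually_nat ?_
  filter_upwards [h.tendsto_atTop_zero.eventually_lt_const (by norm_num : (0 : ℝ) < 1 / 36)]
    with n hn
  have h0 := hσ n
  have he : (1 / (σ n + 1) - 1 / 2) ^ 2 = (σ n - 1) ^ 2 / (4 * (σ n + 1) ^ 2) := by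
    field_simp
    ring
  rw [he] at hn ⊢
  rw [div_lt_iff₀ (by positivity)] at hn
  have hσn : σ n < 2 := by nlinarith
  rw [norm_of_nonneg (sq_nonneg _), mul_div_assoc', le_div_iff₀ (by positivity)]
  nlinarith [mul_nonneg (sq_nonneg (σ n - 1)) (by nlinarith : 0 ≤ 36 - 4 * (σ n + 1) ^ 2)]

theorem cauchy_product_equivalent_iff_dilations
    (δ γ σ : ℕ → ℝ) (hγ : ∀ n, 0 < γ n) (hσ : ∀ n, 0 < σ n)
    (P Q : Measure (ℕ → ℝ))
    (hP : IsProjectiveLimit P fun I : Finset ℕ =>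
      Measure.pi fun i : I => cauchyMeasure (δ i.1) (γ i.1))
    (hQ : IsProjectiveLimit Q fun I : Finset ℕ =>
      Measure.pi fun i : I => cauchyMeasure (δ i.1) (σ i.1 * γ i.1)) :
    (P ≪ Q ∧ Q ≪ P) ↔ Summable fun n => (σ n - 1) ^ 2 := by
  have hσγ : ∀ n, 0 < σ n * γ n := fun n => mul_pos (hσ n) (hγ n)
  have := fun n => isProbabilityMeasure_cauchyMeasure (δ n) (hγ n)
  have := fun n => isProbabilityMeasure_cauchyMeasure (δ n) (hσγ n)
  obtain rfl := hP.unique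
    (Measure.isProjectiveLimit_infinitePi fun n => cauchyMeasure (δ n) (γ n))
  obtain rfl := hQ.unique
    (Measure.isProjectiveLimit_infinitePi fun n => cauchyMeasure (δ n) (σ n * γ n))
  constructor
  · rintro ⟨-, hac⟩
    have h := summable_sq_integral_sub_of_infinitePi_absolutelyContinuous _ _
      (φ := fun n x => γ n ^ 2 / ((x - δ n) ^ 2 + γ n ^ 2)) (fun n => by fun_prop)
      (fun n => sq_div_mem_Icc (δ n) (hγ n)) hac
    simp_rw [integral_cauchyMeasure_sq_div _ (hγ _) (hγ _),
      integral_cauchyMeasure_sq_div _ (hσγ _) (hγ _)] at h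
    refine summable_sq_sub_one_of_summable_sq_inv_sub hσ (h.congr fun n => ?_)
    have := hγ n
    have := hσ n
    congr 1
    field_simp
    ring
  · intro h
    have hsum := summable_sq_sub_one_div hσ h
    refine ⟨?_, infinitePi_cauchyMeasure_absolutelyContinuous hγ hσ hsum⟩
    have hsum' : Summable fun n => ((σ n)⁻¹ - 1) ^ 2 / (σ n)⁻¹ := hsum.congr fun n => by
      have := hσ n
      field_simp
      ring
    have hac := infinitePi_cauchyMeasure_absolutelyContinuous (δ := δ) hσγ
      (fun n => inv_pos.2 (hσ n)) hsum'
    simpa only [inv_mul_cancel_left₀ (hσ _).ne'] using hac
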